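/- arXiv:1511.06339 — 2 statements merged into one kernel-verified Lean document; each statement's English description precedes it below -/
import Mathlib

section
/- Let n ≥ 1 and let U ⊆ ℝ^n × ℝ^n be the open set of pairs (x,p) with the x_i pairwise distinct. For λ ∈ ℝ define E(λ)(x,p) = xᵀ·adjugate(λ·Id − L(x,p))·e and G(λ)(x,p) = trace(X(x)·adjugate(λ·Id − L(x,p))). Then for every k ≥ 1, every λ ∈ ℝ and every (x,p) ∈ U, the canonical Poisson bracket satisfies {(1/k)·trace(L^k), E(λ) − G(λ)}(x,p) = 0. -/
open Matrix

/-- The Calogero–Moser Lax matrix: `L i i = p i`, `L i j = 1/(x i - x j)` for `i ≠ j`. -/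
noncomputable def laxMatrix {n : ℕ} (x p : Fin n → ℝ) : Matrix (Fin n) (Fin n) ℝ :=
  Matrix.of fun i j => if i = j then p i else 1 / (x i - x j)

/-- The canonical Poisson bracket on `ℝⁿ × ℝⁿ` (positions `x = z.1`, momenta `p = z.2`):
`{F,G}(x,p) = ∑ i (∂F/∂xᵢ·∂G/∂pᵢ − ∂F/∂pᵢ·∂G/∂xᵢ)`. -/
noncomputable def poissonBracket {n : ℕ} (F G : (Fin n → ℝ) × (Fin n → ℝ) → ℝ)
    (z : (Fin n → ℝ) × (Fin n → ℝ)) : ℝ :=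
  ∑ i : Fin n,
    (fderiv ℝ F z (Pi.single i 1, 0) * fderiv ℝ G z (0, Pi.single i 1)
      - fderiv ℝ F z (0, Pi.single i 1) * fderiv ℝ G z (Pi.single i 1, 0))

/-- Sklyanin's generating function `E(λ)(x,p) = xᵀ·adjugate(λ·Id − L(x,p))·e`. -/
noncomputable def sklE {n : ℕ} (lam : ℝ) (z : (Fin n → ℝ) × (Fin n → ℝ)) : ℝ :=
  z.1 ⬝ᵥ ((lam • (1 : Matrix (Fin n) (Fin n) ℝ) - laxMatrix z.1 z.2).adjugate.mulVec
    (fun _ => (1 : ℝ)))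

/-- The generating function `G(λ)(x,p) = trace(X(x)·adjugate(λ·Id − L(x,p)))`. -/
noncomputable def sklG {n : ℕ} (lam : ℝ) (z : (Fin n → ℝ) × (Fin n → ℝ)) : ℝ :=
  (Matrix.diagonal z.1 * (lam • (1 : Matrix (Fin n) (Fin n) ℝ) - laxMatrix z.1 z.2).adjugate).trace

namespace CMaux

def HD {n : ℕ} (A : ℝ → Matrix (Fin n) (Fin n) ℝ) (A' : Matrix (Fin n) (Fin n) ℝ) : Prop :=
  ∀ i j, HasDerivAt (fun t => A t i j) (A' i j) 0

lemma HD.mul {n : ℕ} {A B : ℝ → Matrix (Fin n) (Fin n) ℝ} {A' B' : Matrix (Fin n) (Fin n) ℝ}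
    (hA : HD A A') (hB : HD B B') : HD (fun t => A t * B t) (A' * B 0 + A 0 * B') := by
  intro i j
  simp only [Matrix.mul_apply, Matrix.add_apply, ← Finset.sum_add_distrib]
  exact HasDerivAt.fun_sum fun l _ => (hA i l).mul (hB l j)

lemma HD.const {n : ℕ} (B : Matrix (Fin n) (Fin n) ℝ) : HD (fun _ => B) 0 := by
  intro i j
  simpa using hasDerivAt_const (0 : ℝ) (B i j)

lemma HD.trace {n : ℕ} {A : ℝ → Matrix (Fin n) (Fin n) ℝ} {A' : Matrix (Fin n) (Fin n) ℝ}
    (hA : HD A A') : HasDerivAt (fun t => (A t).trace) A'.trace 0 := by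
  simp only [Matrix.trace, Matrix.diag]
  exact HasDerivAt.fun_sum fun l _ => hA l l

lemma HD.unique {n : ℕ} {A : ℝ → Matrix (Fin n) (Fin n) ℝ} {A' B' : Matrix (Fin n) (Fin n) ℝ}
    (hA : HD A A') (hB : HD A B') : A' = B' := by
  ext i j
  exact (hA i j).unique (hB i j)

lemma HD.pow {n : ℕ} {A : ℝ → Matrix (Fin n) (Fin n) ℝ} {A' : Matrix (Fin n) (Fin n) ℝ}
    (hA : HD A A') (m : ℕ) : ∃ D, HD (fun t => A t ^ (m + 1)) D ∧
      ∀ C, Commute C (A 0) → (C * D).trace = (m + 1 : ℝ) * (C * A 0 ^ m * A').trace := by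
  induction m with
  | zero => exact ⟨A', by simpa using hA, by simp⟩
  | succ m ih =>
    obtain ⟨D, hD, h⟩ := ih
    refine ⟨_, by simpa only [pow_succ _ (m + 1)] using hD.mul hA, ?_⟩
    intro C hC
    have h1 := h (A 0 * C) ((Commute.refl _).mul_left hC)
    have h2 : (C * (D * A 0)).trace = (A 0 * C * D).trace := by
      rw [← mul_assoc, Matrix.trace_mul_comm, mul_assoc]
    have h3 : A 0 * C * A 0 ^ m = C * A 0 ^ (m + 1) := by
      rw [← hC.eq, mul_assoc, ← pow_succ']
    rw [mul_add, Matrix.trace_add, h2, h1, h3, ← mul_assoc]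
    push_cast
    ring

lemma det_diff {n : ℕ} : Differentiable ℝ
    (fun N : Fin n → Fin n → ℝ => (Matrix.of N).det) := by
  simp only [Matrix.det_apply, Matrix.of_apply]
  fun_prop

lemma adj_diff {n : ℕ} (i j : Fin n) : Differentiable ℝ
    (fun N : Fin n → Fin n → ℝ => (Matrix.of N).adjugate i j) := by
  simp only [Matrix.adjugate_apply]
  have : Differentiable ℝ (fun N : Fin n → Fin n → ℝ =>
      (fun a b => (Matrix.of N).updateRow j (Pi.single i 1) a b)) := by
    refine differentiable_pi.2 fun a => differentiable_pi.2 fun b => ?_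
    by_cases h : a = j
    · subst h; simp
    · simp only [Matrix.updateRow_ne h, Matrix.of_apply]
      fun_prop
  exact det_diff.comp this

lemma HD.adj_exists {n : ℕ} (N V : Matrix (Fin n) (Fin n) ℝ) :
    ∃ D, ∀ A : ℝ → Matrix (Fin n) (Fin n) ℝ, A 0 = N → HD A V →
      HD (fun t => (A t).adjugate) D := by
  refine ⟨Matrix.of fun i j => fderiv ℝ
    (fun N : Fin n → Fin n → ℝ => (Matrix.of N).adjugate i j) N V, ?_⟩
  intro A h0 hA i j
  have h1 : HasDerivAt (fun t => (fun a b => A t a b : Fin n → Fin n → ℝ)) (fun a b => V a b) 0 :=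
    hasDerivAt_pi.2 fun a => hasDerivAt_pi.2 fun b => hA a b
  have h2 := (adj_diff i j (fun a b => A 0 a b)).hasFDerivAt.comp_hasDerivAt (0 : ℝ) h1
  subst h0
  exact h2

lemma adj_conj {n : ℕ} {P Q : Matrix (Fin n) (Fin n) ℝ} (N : Matrix (Fin n) (Fin n) ℝ)
    (h : Q * P = 1) : (Q * N * P).adjugate = Q * N.adjugate * P := by
  have h' : P * Q = 1 := mul_eq_one_comm.1 h
  have hP : P.adjugate = P.det • Q := by
    calc P.adjugate = (P.adjugate * P) * Q := by rw [mul_assoc, h', mul_one]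
      _ = _ := by rw [Matrix.adjugate_mul, Matrix.smul_mul, one_mul]
  have hQ : Q.adjugate = Q.det • P := by
    calc Q.adjugate = (Q.adjugate * Q) * P := by rw [mul_assoc, h, mul_one]
      _ = _ := by rw [Matrix.adjugate_mul, Matrix.smul_mul, one_mul]
  have hd : Q.det * P.det = 1 := by rw [← Matrix.det_mul, h, Matrix.det_one]
  rw [Matrix.adjugate_mul_distrib, Matrix.adjugate_mul_distrib, hP, hQ]
  simp only [Matrix.smul_mul, Matrix.mul_smul, smul_smul, hd, one_smul, mul_assoc]

lemma adj_comm {n : ℕ} (N M : Matrix (Fin n) (Fin n) ℝ)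
    (A : ℝ → Matrix (Fin n) (Fin n) ℝ) (h0 : A 0 = N) (hA : HD A (N * M - M * N)) :
    HD (fun t => (A t).adjugate) (N.adjugate * M - M * N.adjugate) := by
  obtain ⟨D, hD⟩ := HD.adj_exists N (N * M - M * N)
  let P : ℝ → Matrix (Fin n) (Fin n) ℝ := fun t => 1 + t • M
  have hP : HD P M := by
    intro i j
    have := ((hasDerivAt_id (0 : ℝ)).mul_const (M i j)).const_add ((1 : Matrix (Fin n) (Fin n) ℝ) i j)
    simpa [P] using this
  have hP0 : P 0 = 1 := by simp [P]
  have hdet : DifferentiableAt ℝ (fun t => (P t).det) 0 := by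
    have h1 : HasDerivAt (fun t => (fun a b => P t a b : Fin n → Fin n → ℝ)) (fun a b => M a b) 0 :=
      hasDerivAt_pi.2 fun a => hasDerivAt_pi.2 fun b => hP a b
    exact ((det_diff (fun a b => P 0 a b)).hasFDerivAt.comp_hasDerivAt (0 : ℝ) h1).differentiableAt
  have hdet0 : (P 0).det ≠ 0 := by simp [hP0]
  obtain ⟨R, hR⟩ := HD.adj_exists 1 M
  have hR := hR P hP0 hP
  let Q : ℝ → Matrix (Fin n) (Fin n) ℝ := fun t => ((P t).det)⁻¹ • (P t).adjugate
  have hQ0 : Q 0 = 1 := by simp [Q, hP0]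
  obtain ⟨Q', hQ⟩ : ∃ Q', HD Q Q' := by
    refine ⟨Matrix.of fun i j => deriv (fun t => Q t i j) 0, fun i j => ?_⟩
    refine DifferentiableAt.hasDerivAt ?_
    exact (hdet.inv hdet0).mul (hR i j).differentiableAt
  have hev : ∀ᶠ t in nhds (0 : ℝ), Q t * P t = 1 := by
    filter_upwards [hdet.continuousAt.eventually_ne hdet0] with t ht
    simp only [Q, Matrix.smul_mul, Matrix.adjugate_mul, smul_smul]
    rw [inv_mul_cancel₀ ht, one_smul]
  have hQM : Q' = - M := by
    have h1 := hQ.mul hP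
    have h2 : HD (fun t => Q t * P t) 0 := by
      intro i j
      refine (HD.const 1 i j).congr_of_eventuallyEq ?_
      filter_upwards [hev] with t ht
      simp [ht]
    have := h1.unique h2
    rw [hP0, hQ0, mul_one, one_mul] at this
    exact eq_neg_of_add_eq_zero_left this
  subst hQM
  have conj : ∀ B, HD (fun t => Q t * B * P t) (B * M - M * B) := by
    intro B
    have := (hQ.mul (HD.const B)).mul hP
    simp only [hQ0, hP0] at this
    convert this using 1
    noncomm_ring
  have h3 := hD (fun t => Q t * N * P t) (by simp [hQ0, hP0]) (conj N)
  have h4 : HD (fun t => (Q t * N * P t).adjugate) (N.adjugate * M - M * N.adjugate) := by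
    intro i j
    refine (conj N.adjugate i j).congr_of_eventuallyEq ?_
    filter_upwards [hev] with t ht
    simp [adj_conj N ht]
  rw [h4.unique h3]
  exact hD A h0 hA

/-- derivative of Lax matrix -/
noncomputable def DL {n : ℕ} (x : Fin n → ℝ) (v : (Fin n → ℝ) × (Fin n → ℝ)) :
    Matrix (Fin n) (Fin n) ℝ :=
  Matrix.of fun i j => (if i = j then v.2 i else 0) - (v.1 i - v.1 j) * ((x i - x j)⁻¹) ^ 2

lemma lax_apply {n : ℕ} (x p : Fin n → ℝ) (i j : Fin n) :
    laxMatrix x p i j = (if i = j then p i else 0) + (x i - x j)⁻¹ := by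
  simp only [laxMatrix, Matrix.of_apply]
  split_ifs with h
  · subst h; simp
  · simp

lemma lax_diff {n : ℕ} (z : (Fin n → ℝ) × (Fin n → ℝ)) (hz : Function.Injective z.1)
    (i j : Fin n) : DifferentiableAt ℝ (fun w : (Fin n → ℝ) × (Fin n → ℝ) =>
      laxMatrix w.1 w.2 i j) z := by
  simp only [laxMatrix, Matrix.of_apply]
  split_ifs with h
  · fun_prop
  · have : z.1 i - z.1 j ≠ 0 := sub_ne_zero.2 fun e => h (hz e)
    fun_prop (disch := assumption)

lemma lax_HD {n : ℕ} (z v : (Fin n → ℝ) × (Fin n → ℝ)) (hz : Function.Injective z.1) :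
    HD (fun t => laxMatrix (z + t • v).1 (z + t • v).2) (DL z.1 v) := by
  intro i j
  have lin : ∀ a b : ℝ, HasDerivAt (fun t : ℝ => a + t * b) b 0 := fun a b => by
    simpa using ((hasDerivAt_id (0 : ℝ)).mul_const b).const_add a
  simp only [laxMatrix, DL, Matrix.of_apply]
  split_ifs with h
  · subst h
    simpa using lin (z.2 i) (v.2 i)
  · have hne : z.1 i - z.1 j ≠ 0 := sub_ne_zero.2 fun e => h (hz e)
    have := ((lin (z.1 i) (v.1 i)).sub (lin (z.1 j) (v.1 j))).inv (by simpa using hne)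
    simp only [Prod.fst_add, Prod.smul_fst, Pi.add_apply, Pi.smul_apply, smul_eq_mul, one_div]
    refine HasDerivAt.congr_deriv this ?_
    simp
    field_simp
    ring

lemma fderiv_line {n : ℕ} {F : (Fin n → ℝ) × (Fin n → ℝ) → ℝ} {z : (Fin n → ℝ) × (Fin n → ℝ)}
    (hF : DifferentiableAt ℝ F z) (v : (Fin n → ℝ) × (Fin n → ℝ)) :
    HasDerivAt (fun t : ℝ => F (z + t • v)) (fderiv ℝ F z v) 0 := by
  have h1 : HasDerivAt (fun t : ℝ => z + t • v) v 0 := by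
    simpa using ((hasDerivAt_id (0 : ℝ)).smul_const v).const_add z
  have h2 : HasFDerivAt F (fderiv ℝ F z) (z + (0 : ℝ) • v) := by simpa using hF.hasFDerivAt
  exact h2.comp_hasDerivAt (0 : ℝ) h1

lemma pow_diff {n : ℕ} (z : (Fin n → ℝ) × (Fin n → ℝ)) (hz : Function.Injective z.1) (k : ℕ)
    (i j : Fin n) : DifferentiableAt ℝ (fun w : (Fin n → ℝ) × (Fin n → ℝ) =>
      (laxMatrix w.1 w.2 ^ k) i j) z := by
  induction k generalizing i j with
  | zero => simp
  | succ k ih =>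
    simp only [pow_succ, Matrix.mul_apply]
    exact DifferentiableAt.fun_sum fun l _ => (ih i l).mul (lax_diff z hz l j)

lemma fderiv_trace {n : ℕ} (z v : (Fin n → ℝ) × (Fin n → ℝ)) (hz : Function.Injective z.1)
    (m : ℕ) :
    fderiv ℝ (fun w : (Fin n → ℝ) × (Fin n → ℝ) =>
      (1 / ((m + 1 : ℕ) : ℝ)) * ((laxMatrix w.1 w.2) ^ (m + 1)).trace) z v
      = (laxMatrix z.1 z.2 ^ m * DL z.1 v).trace := by
  have hd : DifferentiableAt ℝ (fun w : (Fin n → ℝ) × (Fin n → ℝ) =>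
      (1 / ((m + 1 : ℕ) : ℝ)) * ((laxMatrix w.1 w.2) ^ (m + 1)).trace) z := by
    simp only [Matrix.trace, Matrix.diag]
    exact (DifferentiableAt.fun_sum fun l _ => pow_diff z hz (m + 1) l l).const_mul _
  obtain ⟨D, hD, h⟩ := (lax_HD z v hz).pow m
  have h1 := h 1 (Commute.one_left _)
  have h2 := (fderiv_line hd v).unique (hD.trace.const_mul (1 / ((m + 1 : ℕ) : ℝ)))
  rw [h2]
  simp only [one_mul, zero_smul, add_zero] at h1
  rw [h1]
  push_cast
  field_simp

def JJ (n : ℕ) : Matrix (Fin n) (Fin n) ℝ := Matrix.of fun _ _ => 1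

lemma H_eq {n : ℕ} (lam : ℝ) (w : (Fin n → ℝ) × (Fin n → ℝ)) :
    sklE lam w - sklG lam w = (Matrix.diagonal w.1 *
      (lam • (1 : Matrix (Fin n) (Fin n) ℝ) - laxMatrix w.1 w.2).adjugate * (JJ n - 1)).trace := by
  rw [mul_sub, Matrix.trace_sub, mul_one]
  unfold sklE sklG
  congr 1
  simp [Matrix.trace, Matrix.diag, dotProduct, Matrix.mulVec, Matrix.mul_apply, JJ,
    Matrix.diagonal_apply, Finset.mul_sum]

lemma H_diff {n : ℕ} (lam : ℝ) (z : (Fin n → ℝ) × (Fin n → ℝ)) (hz : Function.Injective z.1) :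
    DifferentiableAt ℝ (fun w => sklE lam w - sklG lam w) z := by
  have hN : DifferentiableAt ℝ (fun w : (Fin n → ℝ) × (Fin n → ℝ) => (fun a b =>
      (lam • (1 : Matrix (Fin n) (Fin n) ℝ) - laxMatrix w.1 w.2) a b : Fin n → Fin n → ℝ)) z := by
    refine differentiableAt_pi.2 fun a => differentiableAt_pi.2 fun b => ?_
    simp only [Matrix.sub_apply]
    exact (lax_diff z hz a b).const_sub _
  have hA : ∀ i j, DifferentiableAt ℝ (fun w : (Fin n → ℝ) × (Fin n → ℝ) =>
      (lam • (1 : Matrix (Fin n) (Fin n) ℝ) - laxMatrix w.1 w.2).adjugate i j) z := fun i j =>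
    (adj_diff i j _).comp z hN
  unfold sklE sklG
  simp only [Matrix.trace, Matrix.diag, dotProduct, Matrix.mulVec, Matrix.diagonal_mul]
  fun_prop

lemma fderiv_H {n : ℕ} (lam : ℝ) (z v : (Fin n → ℝ) × (Fin n → ℝ)) (hz : Function.Injective z.1)
    (M A : Matrix (Fin n) (Fin n) ℝ)
    (hM : DL z.1 v = laxMatrix z.1 z.2 * M - M * laxMatrix z.1 z.2)
    (hA : A = (lam • (1 : Matrix (Fin n) (Fin n) ℝ) - laxMatrix z.1 z.2).adjugate) :
    fderiv ℝ (fun w => sklE lam w - sklG lam w) z v =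
      ((Matrix.diagonal v.1 * A + Matrix.diagonal z.1 * (A * M - M * A)) * (JJ n - 1)).trace := by
  have hN : HD (fun t => lam • (1 : Matrix (Fin n) (Fin n) ℝ) -
      laxMatrix (z + t • v).1 (z + t • v).2)
      ((lam • (1 : Matrix (Fin n) (Fin n) ℝ) - laxMatrix z.1 z.2) * M -
        M * (lam • (1 : Matrix (Fin n) (Fin n) ℝ) - laxMatrix z.1 z.2)) := by
    intro i j
    have := (lax_HD z v hz i j).const_sub ((lam • (1 : Matrix (Fin n) (Fin n) ℝ)) i j)
    simp only [Matrix.sub_apply] at this ⊢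
    refine HasDerivAt.congr_deriv this ?_
    rw [hM]
    simp [sub_mul, mul_sub]
  have h1 := adj_comm _ _ _ (by simp) hN
  have hX : HD (fun t => Matrix.diagonal (z + t • v).1) (Matrix.diagonal v.1) := by
    intro i j
    by_cases h : i = j
    · subst h
      simpa using ((hasDerivAt_id (0 : ℝ)).mul_const (v.1 i)).const_add (z.1 i)
    · simpa [h] using hasDerivAt_const (0 : ℝ) (0 : ℝ)
  have h2 := ((hX.mul h1).mul (HD.const (JJ n - 1))).trace
  have h3 := fderiv_line (H_diff lam z hz) v
  simp only [H_eq] at h3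
  rw [show (fun w => sklE lam w - sklG lam w) = _ from funext (H_eq lam)]
  rw [h3.unique h2, hA]
  simp

lemma final_alg {n : ℕ} (X L M Q A J X' : Matrix (Fin n) (Fin n) ℝ)
    (hX : X' = X * M - M * X + Q) (hJ : X * L - L * X = J - 1) (h1 : M * J = 0) (h2 : J * M = 0)
    (hQ : Commute Q L) (hA : Commute A L) :
    ((X' * A + X * (A * M - M * A)) * (J - 1)).trace = 0 := by
  have e1 : (X' * A + X * (A * M - M * A)) = (X * A) * M - M * (X * A) + Q * A := by
    rw [hX]; noncomm_ring
  have e2 : (Q * A * (J - 1)).trace = 0 := by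
    rw [← hJ, mul_sub, Matrix.trace_sub, ← mul_assoc, ← mul_assoc,
      Matrix.trace_mul_comm (Q * A * X) L, ← mul_assoc, (hQ.mul_left hA).eq, sub_self]
  have e3 : ((X * A) * M * J).trace = 0 := by rw [mul_assoc, h1]; simp
  have e4 : (M * (X * A) * J).trace = 0 := by
    rw [mul_assoc, Matrix.trace_mul_comm, mul_assoc, h2]; simp
  rw [e1, add_mul, Matrix.trace_add, e2, sub_mul, mul_sub, mul_sub]
  simp only [Matrix.trace_sub, e3, e4, mul_one]
  rw [Matrix.trace_mul_comm (X * A) M]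
  ring

lemma XL {n : ℕ} (x p : Fin n → ℝ) (hx : Function.Injective x) :
    Matrix.diagonal x * laxMatrix x p - laxMatrix x p * Matrix.diagonal x = JJ n - 1 := by
  ext i j
  simp only [Matrix.sub_apply, Matrix.diagonal_mul, Matrix.mul_diagonal, JJ, Matrix.of_apply,
    Matrix.one_apply, laxMatrix]
  split_ifs with h
  · subst h; ring
  · have hne : x i - x j ≠ 0 := sub_ne_zero.2 fun e => h (hx e)
    field_simp
    simp

noncomputable def MM {n : ℕ} (x : Fin n → ℝ) (Q : Matrix (Fin n) (Fin n) ℝ) :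
    Matrix (Fin n) (Fin n) ℝ :=
  Matrix.of fun i j => (if i = j then ∑ l, Q i l * (x i - x l)⁻¹ else 0) - Q i j * (x i - x j)⁻¹

lemma MJ {n : ℕ} (x : Fin n → ℝ) (Q : Matrix (Fin n) (Fin n) ℝ) : MM x Q * JJ n = 0 := by
  ext i j
  simp [Matrix.mul_apply, MM, JJ]

lemma inv_anti (a b : ℝ) : (a - b)⁻¹ = - (b - a)⁻¹ := by
  rw [← neg_sub, inv_neg]

lemma JM {n : ℕ} (x p : Fin n → ℝ) (Q : Matrix (Fin n) (Fin n) ℝ)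
    (hQ : Commute Q (laxMatrix x p)) : JJ n * MM x Q = 0 := by
  ext i j
  have h := congrFun (congrFun hQ.eq j) j
  simp only [Matrix.mul_apply, lax_apply, mul_add, add_mul, Finset.sum_add_distrib] at h
  simp at h
  have h5 : ∑ l, Q j l * (x l - x j)⁻¹ = - ∑ l, Q j l * (x j - x l)⁻¹ := by
    rw [← Finset.sum_neg_distrib]
    exact Finset.sum_congr rfl fun l _ => by rw [inv_anti]; ring
  have h6 : ∑ l, (x j - x l)⁻¹ * Q l j = - ∑ l, Q l j * (x l - x j)⁻¹ := by
    rw [← Finset.sum_neg_distrib]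
    exact Finset.sum_congr rfl fun l _ => by rw [inv_anti]; ring
  rw [h5, h6] at h
  simp [Matrix.mul_apply, MM, JJ]
  linarith

lemma Xdot {n : ℕ} (x : Fin n → ℝ) (hx : Function.Injective x) (Q : Matrix (Fin n) (Fin n) ℝ) :
    Matrix.diagonal (fun i => Q i i) =
      Matrix.diagonal x * MM x Q - MM x Q * Matrix.diagonal x + Q := by
  ext i j
  simp only [Matrix.sub_apply, Matrix.add_apply, Matrix.diagonal_mul, Matrix.mul_diagonal, MM,
    Matrix.of_apply, Matrix.diagonal_apply]
  split_ifs with h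
  · subst h; ring
  · have hne : x i - x j ≠ 0 := sub_ne_zero.2 fun e => h (hx e)
    field_simp
    ring

lemma tr_p {n : ℕ} (x : Fin n → ℝ) (Q : Matrix (Fin n) (Fin n) ℝ) (i : Fin n) :
    (Q * DL x (0, Pi.single i 1)).trace = Q i i := by
  simp [Matrix.trace, Matrix.mul_apply, DL, Pi.single_apply]

lemma tr_x {n : ℕ} (x : Fin n → ℝ) (Q : Matrix (Fin n) (Fin n) ℝ) (i : Fin n) :
    (Q * DL x (Pi.single i 1, 0)).trace =
      ∑ l, (Q i l - Q l i) * ((x i - x l)⁻¹) ^ 2 := by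
  have : ∀ a b, Q a b * DL x (Pi.single i 1, 0) b a =
      (if a = i then Q a b * ((x b - x a)⁻¹) ^ 2 else 0) -
      (if b = i then Q a b * ((x b - x a)⁻¹) ^ 2 else 0) := by
    intro a b
    simp only [DL, Matrix.of_apply, Pi.single_apply, Pi.zero_apply]
    split_ifs <;> ring
  simp only [Matrix.trace, Matrix.diag, Matrix.mul_apply, this, Finset.sum_sub_distrib]
  rw [Finset.sum_comm]
  simp only [Finset.sum_ite_eq', Finset.mem_univ, if_true, sub_mul, Finset.sum_sub_distrib]
  congr 1
  exact Finset.sum_congr rfl fun l _ => by rw [inv_anti]; ring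

lemma lax_eq {n : ℕ} (x p : Fin n → ℝ) (hx : Function.Injective x)
    (Q : Matrix (Fin n) (Fin n) ℝ) (hQ : Commute Q (laxMatrix x p)) :
    DL x (fun i => Q i i, fun i => - ∑ l, (Q i l - Q l i) * ((x i - x l)⁻¹) ^ 2) =
      laxMatrix x p * MM x Q - MM x Q * laxMatrix x p := by
  set L := laxMatrix x p with hL
  set M := MM x Q with hM
  set V := DL x (fun i => Q i i, fun i => - ∑ l, (Q i l - Q l i) * ((x i - x l)⁻¹) ^ 2) with hV
  set X := Matrix.diagonal x with hX
  have k1 : X * V - V * X + (Matrix.diagonal (fun i => Q i i) * L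
      - L * Matrix.diagonal (fun i => Q i i)) = 0 := by
    ext i j
    simp only [hX, hV, hL, Matrix.sub_apply, Matrix.add_apply, Matrix.diagonal_mul,
      Matrix.mul_diagonal, DL, Matrix.of_apply, lax_apply, Matrix.zero_apply]
    by_cases h : i = j
    · subst h; ring
    · have hne : x i - x j ≠ 0 := sub_ne_zero.2 fun e => h (hx e)
      simp only [h, if_false]
      field_simp
      ring
  have k2 : X * (L * M - M * L) - (L * M - M * L) * X + (Matrix.diagonal (fun i => Q i i) * L
      - L * Matrix.diagonal (fun i => Q i i)) = 0 := by
    rw [Xdot x hx Q]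
    have e : X * (L * M - M * L) - (L * M - M * L) * X + ((X * M - M * X + Q) * L
      - L * (X * M - M * X + Q)) = (X * L - L * X) * M - M * (X * L - L * X) + (Q * L - L * Q) := by
      noncomm_ring
    rw [e, XL x p hx, hQ.eq, sub_mul, mul_sub, JM x p Q hQ, MJ]
    simp
  have k3 := add_right_cancel (k1.trans k2.symm)
  ext i j
  by_cases h : i = j
  · subst h
    have c : ∀ l, L i l * M l i - M i l * L l i =
        - ((Q i l - Q l i) * ((x i - x l)⁻¹) ^ 2) := by
      intro l
      by_cases h : i = l
      · subst h; simp; ring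
      · simp only [hL, hM, lax_apply, MM, Matrix.of_apply, h, Ne.symm h, if_false]
        rw [inv_anti (x l) (x i)]
        ring
    rw [Matrix.sub_apply, Matrix.mul_apply, Matrix.mul_apply, ← Finset.sum_sub_distrib,
      Finset.sum_congr rfl fun l _ => c l]
    simp [hV, DL]
  · have hne : x i - x j ≠ 0 := sub_ne_zero.2 fun e => h (hx e)
    have k4 := congrFun (congrFun k3 i) j
    rw [Matrix.sub_apply, Matrix.sub_apply] at k4
    simp only [hX, Matrix.diagonal_mul, Matrix.mul_diagonal] at k4
    refine mul_left_cancel₀ hne ?_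
    linarith

lemma bracket_eq {n : ℕ} (F G : (Fin n → ℝ) × (Fin n → ℝ) → ℝ)
    (z : (Fin n → ℝ) × (Fin n → ℝ)) : poissonBracket F G z =
      - fderiv ℝ G z (fun i => fderiv ℝ F z (0, Pi.single i 1),
          fun i => - fderiv ℝ F z (Pi.single i 1, 0)) := by
  have hv : ((fun i => fderiv ℝ F z (0, Pi.single i 1),
          fun i => - fderiv ℝ F z (Pi.single i 1, 0)) : (Fin n → ℝ) × (Fin n → ℝ)) =
      ∑ i, (fderiv ℝ F z (0, Pi.single i 1) • ((Pi.single i 1, 0) : (Fin n → ℝ) × (Fin n → ℝ))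
        - fderiv ℝ F z (Pi.single i 1, 0) • ((0, Pi.single i 1) : (Fin n → ℝ) × (Fin n → ℝ))) := by
    ext j
    · simp [Prod.fst_sum, Finset.sum_apply, Pi.single_apply]
    · simp [Prod.snd_sum, Finset.sum_apply, Pi.single_apply]
  rw [hv, map_sum, ← Finset.sum_neg_distrib, poissonBracket]
  refine Finset.sum_congr rfl fun i _ => ?_
  rw [map_sub, map_smul, map_smul]
  simp only [smul_eq_mul]
  ring

lemma adj_commute {n : ℕ} (lam : ℝ) (L : Matrix (Fin n) (Fin n) ℝ) :
    Commute (lam • (1 : Matrix (Fin n) (Fin n) ℝ) - L).adjugate L := by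
  have h : Commute (lam • (1 : Matrix (Fin n) (Fin n) ℝ) - L).adjugate
      (lam • (1 : Matrix (Fin n) (Fin n) ℝ) - L) := by
    rw [Commute, SemiconjBy, Matrix.adjugate_mul, Matrix.mul_adjugate]
  have h2 : Commute (lam • (1 : Matrix (Fin n) (Fin n) ℝ) - L).adjugate
      (lam • (1 : Matrix (Fin n) (Fin n) ℝ)) := (Commute.one_right _).smul_right lam
  simpa using h2.sub_right h

end CMaux

/-- On the set where the `xᵢ` are pairwise distinct, the spectral invariants
`(1/k)·trace(Lᵏ)` Poisson-commute with `E(λ) − G(λ)`. -/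
theorem bracket_Ik_E_sub_G {n : ℕ} (hn : 1 ≤ n) (k : ℕ) (hk : 1 ≤ k) (lam : ℝ)
    (z : (Fin n → ℝ) × (Fin n → ℝ)) (hz : Function.Injective z.1) :
    poissonBracket (fun w => (1 / (k : ℝ)) * ((laxMatrix w.1 w.2) ^ k).trace)
      (fun w => sklE lam w - sklG lam w) z = 0 := by
  obtain ⟨m, rfl⟩ : ∃ m, k = m + 1 := ⟨k - 1, by omega⟩
  rw [CMaux.bracket_eq]
  simp only [CMaux.fderiv_trace z _ hz m, CMaux.tr_p, CMaux.tr_x]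
  have hQ : Commute (laxMatrix z.1 z.2 ^ m) (laxMatrix z.1 z.2) := Commute.pow_self _ _
  rw [CMaux.fderiv_H lam z _ hz _ _ (CMaux.lax_eq z.1 z.2 hz _ hQ) rfl, neg_eq_zero]
  exact CMaux.final_alg _ _ _ _ _ _ _ (CMaux.Xdot z.1 hz (laxMatrix z.1 z.2 ^ m)) (CMaux.XL z.1 z.2 hz)
    (CMaux.MJ _ _) (CMaux.JM z.1 z.2 _ hQ) hQ (CMaux.adj_commute lam _)
end

section
/- Let n ≥ 1 and let U ⊆ ℝ^n × ℝ^n be an open set of pairs (x,p) with the x_i pairwise distinct. Suppose λ_1,…,λ_n : U → ℝ are smooth, pairwise distinct at every point of U, and satisfy det(λ·Id − L(x,p)) = ∏_{i=1}^n (λ − λ_i(x,p)) for all λ ∈ ℝ and (x,p) ∈ U. Define μ̃_i := (xᵀ·adjugate(λ_i·Id − L)·e)/(eᵀ·adjugate(λ_i·Id − L)·e) and μ_i := trace(X·adjugate(λ_i·Id − L))/trace(adjugate(λ_i·Id − L)). Then the difference μ̃_i − μ_i Poisson-commutes with all the spectral invariants: for every k ≥ 1 and every i, {(1/k)·trace(L^k),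 μ̃_i − μ_i} = 0 on U (so the Sklyanin momenta differ from the Darboux–Nijenhuis momenta by a function of the eigenvalues only, i.e. they are magnetic Darboux–Nijenhuis coordinates). -/
open Matrix

/-- The Sklyanin momenta
`μ̃ᵢ = (xᵀ·adjugate(λᵢ·Id − L)·e)/(eᵀ·adjugate(λᵢ·Id − L)·e)`. -/
noncomputable def sklyaninMu {n : ℕ} (lam : Fin n → ((Fin n → ℝ) × (Fin n → ℝ)) → ℝ)
    (i : Fin n) (z : (Fin n → ℝ) × (Fin n → ℝ)) : ℝ :=
  (z.1 ⬝ᵥ ((lam i z • (1 : Matrix (Fin n) (Fin n) ℝ) - laxMatrix z.1 z.2).adjugate.mulVec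
      (fun _ => (1 : ℝ)))) /
    ((fun _ => (1 : ℝ)) ⬝ᵥ
      ((lam i z • (1 : Matrix (Fin n) (Fin n) ℝ) - laxMatrix z.1 z.2).adjugate.mulVec
        (fun _ => (1 : ℝ))))

/-- The Darboux–Nijenhuis momenta
`μᵢ = trace(X·adjugate(λᵢ·Id − L))/trace(adjugate(λᵢ·Id − L))`. -/
noncomputable def dnMu {n : ℕ} (lam : Fin n → ((Fin n → ℝ) × (Fin n → ℝ)) → ℝ)
    (i : Fin n) (z : (Fin n → ℝ) × (Fin n → ℝ)) : ℝ :=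
  (Matrix.diagonal z.1 *
      (lam i z • (1 : Matrix (Fin n) (Fin n) ℝ) - laxMatrix z.1 z.2).adjugate).trace /
    ((lam i z • (1 : Matrix (Fin n) (Fin n) ℝ) - laxMatrix z.1 z.2).adjugate).trace

def MD {n : ℕ} (F : ℝ → Matrix (Fin n) (Fin n) ℝ) (F' : Matrix (Fin n) (Fin n) ℝ) (t : ℝ): Prop :=
  ∀ i j, HasDerivAt (fun s => F s i j) (F' i j) t

theorem MD.mul {n : ℕ} {F G : ℝ → Matrix (Fin n) (Fin n) ℝ} {F' G' : Matrix (Fin n) (Fin n) ℝ} {t : ℝ}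
    (hF : MD F F' t) (hG : MD G G' t) : MD (fun s => F s * G s) (F' * G t + F t * G') t := by
  intro i j
  simp only [Matrix.mul_apply, Matrix.add_apply, ← Finset.sum_add_distrib]
  exact HasDerivAt.fun_sum fun l _ => (hF i l).mul (hG l j)

theorem MD.const {n : ℕ} (C : Matrix (Fin n) (Fin n) ℝ) (t : ℝ) : MD (fun _ => C) 0 t :=
  fun _ _ => hasDerivAt_const _ _

theorem MD.trace {n : ℕ} {F : ℝ → Matrix (Fin n) (Fin n) ℝ} {F' : Matrix (Fin n) (Fin n) ℝ} {t : ℝ}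
    (hF : MD F F' t) : HasDerivAt (fun s => (F s).trace) F'.trace t := by
  simp only [Matrix.trace]
  exact HasDerivAt.fun_sum fun l _ => hF l l

theorem MD.unique {n : ℕ} {F : ℝ → Matrix (Fin n) (Fin n) ℝ} {F' G' : Matrix (Fin n) (Fin n) ℝ} {t : ℝ}
    (hF : MD F F' t) (hG : MD F G' t) : F' = G' := by
  ext i j; exact (hF i j).unique (hG i j)

theorem MD.det {n : ℕ} {F : ℝ → Matrix (Fin n) (Fin n) ℝ} {F' : Matrix (Fin n) (Fin n) ℝ} {t : ℝ}
    (hF : MD F F' t) : HasDerivAt (fun s => (F s).det) ((F t).adjugate * F').trace t := by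
  have h1 : HasDerivAt (fun s => (F s).det)
      (∑ i, ((F t).updateCol i (fun l => F' l i)).det) t := by
    have : ∑ i, ((F t).updateCol i (fun l => F' l i)).det =
        ∑ σ : Equiv.Perm (Fin n), ((Equiv.Perm.sign σ : ℤ) : ℝ) *
          ∑ i, (∏ j ∈ Finset.univ.erase i, F t (σ j) j) • F' (σ i) i := by
      simp only [Matrix.det_apply', Finset.mul_sum]
      rw [Finset.sum_comm]
      refine Finset.sum_congr rfl fun σ _ => Finset.sum_congr rfl fun i _ => ?_
      congr 1
      rw [← Finset.mul_prod_erase _ _ (Finset.mem_univ i), mul_comm, smul_eq_mul]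
      congr 1
      · refine Finset.prod_congr rfl fun j hj => ?_
        rw [Matrix.updateCol_ne (Finset.ne_of_mem_erase hj)]
      · simp
    rw [this]
    simp only [Matrix.det_apply']
    exact HasDerivAt.fun_sum fun σ _ =>
      (HasDerivAt.fun_finsetProd fun i _ => hF (σ i) i).const_mul _
  convert h1 using 1
  simp only [Matrix.trace, Matrix.diag]
  refine Finset.sum_congr rfl fun i _ => ?_
  rw [← Matrix.cramer_apply, Matrix.cramer_eq_adjugate_mulVec]
  rfl

def dadj {n : ℕ} (N N' : Matrix (Fin n) (Fin n) ℝ) : Matrix (Fin n) (Fin n) ℝ :=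
  Matrix.of fun i j => ((N.updateRow j (Pi.single i 1)).adjugate * (N'.updateRow j 0)).trace

theorem MD.adj {n : ℕ} {F : ℝ → Matrix (Fin n) (Fin n) ℝ} {F' : Matrix (Fin n) (Fin n) ℝ} {t : ℝ}
    (hF : MD F F' t) : MD (fun s => (F s).adjugate) (dadj (F t) F') t := by
  intro i j
  simp only [Matrix.adjugate_apply]
  refine MD.det (F := fun s => (F s).updateRow j (Pi.single i 1)) (F' := F'.updateRow j 0) ?_
  intro a b
  by_cases h : a = j
  · subst h; simpa using hasDerivAt_const _ _
  · simpa [Matrix.updateRow_ne h] using hF a b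

theorem MD.affine {n : ℕ} (C D : Matrix (Fin n) (Fin n) ℝ) (t : ℝ) : MD (fun s => C + s • D) D t := by
  intro i j
  simpa using ((hasDerivAt_id t).mul_const (D i j)).const_add (C i j)

theorem MD.congr_deriv {n : ℕ} {F : ℝ → Matrix (Fin n) (Fin n) ℝ} {F' G' : Matrix (Fin n) (Fin n) ℝ} {t : ℝ}
    (hF : MD F F' t) (h : F' = G') : MD F G' t := h ▸ hF

/-- derivative of the adjugate along an infinitesimal conjugation -/
theorem dadj_comm {n : ℕ} (N M : Matrix (Fin n) (Fin n) ℝ) :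
    dadj N (N * M - M * N) = N.adjugate * M - M * N.adjugate := by
  have hp := MD.affine 1 M 0
  have hm := MD.affine 1 (-M) 0
  have hpath := (hm.mul (MD.const N 0)).mul hp
  have h1 := MD.adj hpath
  have h2 := ((MD.adj hp).mul (MD.const N.adjugate 0)).mul (MD.adj hm)
  have heq : (fun s : ℝ => ((1 + s • (-M)) * N * (1 + s • M)).adjugate) =
      fun s : ℝ => (1 + s • M).adjugate * N.adjugate * (1 + s • (-M)).adjugate := by
    funext s; rw [Matrix.adjugate_mul_distrib, Matrix.adjugate_mul_distrib, ← mul_assoc]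
  rw [heq] at h1
  have h3 := h1.unique h2
  -- value of dadj 1 M
  have key : ∀ M : Matrix (Fin n) (Fin n) ℝ, dadj 1 M = M.trace • 1 - M := by
    intro M
    have hp := MD.affine 1 M 0
    have h4 := hp.mul (MD.adj hp)
    have h5 : MD (fun s : ℝ => (1 + s • M) * (1 + s • M).adjugate) (M.trace • 1) 0 := by
      intro i j
      simp only [Matrix.mul_adjugate, Matrix.smul_apply]
      have := (MD.det hp).smul_const ((1 : Matrix (Fin n) (Fin n) ℝ) i j)
      simpa using this
    have h6 := h4.unique h5
    simp at h6
    rw [← h6]; abel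
  simp [key] at h3
  rw [show N * M - M * N = -(M * N) + N * M by abel, h3]
  noncomm_ring

theorem MD.pow_trace {n : ℕ} {F : ℝ → Matrix (Fin n) (Fin n) ℝ} {F' : Matrix (Fin n) (Fin n) ℝ} {t : ℝ}
    (hF : MD F F' t) (k : ℕ) : ∃ D, MD (fun s => F s ^ k) D t ∧
      ∀ C, Commute (F t) C → (D * C).trace = k * (F t ^ (k-1) * F' * C).trace := by
  induction k with
  | zero => exact ⟨0, by simpa using MD.const 1 t, by simp⟩
  | succ k ih =>
    obtain ⟨D, hD, h⟩ := ih
    refine ⟨_, by simpa only [pow_succ] using hD.mul hF, fun C hC => ?_⟩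
    have := h (F t * C) ((Commute.refl _).mul_right hC)
    rw [add_mul, Matrix.trace_add, mul_assoc, this]
    rcases k with _ | k
    · simp
    · rw [hC.eq, ← mul_assoc, Matrix.trace_mul_comm]
      simp only [← mul_assoc, Nat.add_sub_cancel, ← pow_succ']
      push_cast; ring

/-- algebraic core -/
theorem core {n : ℕ} {X L M B A C X' : Matrix (Fin n) (Fin n) ℝ} {l : ℝ} {k : ℕ}
    (hX : X' = -B + (X * M - M * X)) (hB : B = L ^ k) (hA : L * A = l • A)
    (hC : M * C = C * M) :
    (X' * A * C + X * (A * M - M * A) * C).trace = - (l ^ k * (A * C).trace) ∧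
    ((A * M - M * A) * C).trace = 0 := by
  have hp : B * A = l ^ k • A := by
    clear hX
    subst hB
    induction k with
    | zero => simp
    | succ k ih => rw [pow_succ, mul_assoc, hA, mul_smul_comm, ih, smul_smul, pow_succ, mul_comm]
  constructor
  · have : X' * A * C + X * (A * M - M * A) * C = -(l^k • (A * C)) + (X * A * C * M - M * (X * A * C)) := by
      rw [hX, ← smul_mul_assoc, ← hp]
      have : X * A * C * M = X * A * (M * C) := by rw [hC]; noncomm_ring
      rw [this]
      noncomm_ring
    rw [this, Matrix.trace_add, Matrix.trace_sub, Matrix.trace_mul_comm M]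
    simp
  · rw [sub_mul, Matrix.trace_sub, mul_assoc, mul_assoc, hC, Matrix.trace_mul_comm M, ← mul_assoc, sub_self]

/-- derivative of the Lax matrix in the direction `(a, b)` -/
noncomputable def laxD {n : ℕ} (x a b : Fin n → ℝ) : Matrix (Fin n) (Fin n) ℝ :=
  Matrix.of fun i j => if i = j then b i else -(a i - a j) * (1 / (x i - x j)) ^ 2

theorem lax_line {n : ℕ} {z : (Fin n → ℝ) × (Fin n → ℝ)} (hx : Function.Injective z.1)
    (v : (Fin n → ℝ) × (Fin n → ℝ)) :
    MD (fun s : ℝ => laxMatrix (z + s • v).1 (z + s • v).2) (laxD z.1 v.1 v.2) 0 := by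
  intro i j
  by_cases h : i = j
  · subst h
    simp only [laxMatrix, laxD, Matrix.of_apply, if_true, Prod.snd_add, Prod.smul_snd,
      Pi.add_apply, Pi.smul_apply, smul_eq_mul]
    simpa using ((hasDerivAt_id (0 : ℝ)).mul_const (v.2 i)).const_add (z.2 i)
  · simp only [laxMatrix, laxD, Matrix.of_apply, if_neg h, Prod.fst_add, Prod.smul_fst,
      Pi.add_apply, Pi.smul_apply, smul_eq_mul]
    have hne : z.1 i - z.1 j ≠ 0 := sub_ne_zero.2 fun e => h (hx e)
    have h1 : ∀ l, HasDerivAt (fun s : ℝ => z.1 l + s * v.1 l) (v.1 l) 0 := fun l => by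
      simpa using ((hasDerivAt_id (0 : ℝ)).mul_const (v.1 l)).const_add (z.1 l)
    have h2 := ((h1 i).fun_sub (h1 j)).fun_inv (by simpa using hne)
    simp only [one_div]
    refine h2.congr_deriv ?_
    simp [div_eq_mul_inv]

/-- the second Lax matrix -/
noncomputable def laxM {n : ℕ} (x : Fin n → ℝ) (B : Matrix (Fin n) (Fin n) ℝ) :
    Matrix (Fin n) (Fin n) ℝ :=
  Matrix.of fun i j => B i j * (1 / (x i - x j)) -
    if i = j then ∑ l, B i l * (1 / (x i - x l)) else 0

theorem laxM_row {n : ℕ} (x : Fin n → ℝ) (B : Matrix (Fin n) (Fin n) ℝ) (i : Fin n) :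
    ∑ j, laxM x B i j = 0 := by
  simp [laxM]

theorem laxM_col {n : ℕ} (x p : Fin n → ℝ) (B : Matrix (Fin n) (Fin n) ℝ)
    (hB : laxMatrix x p * B = B * laxMatrix x p) (j : Fin n) :
    ∑ i, laxM x B i j = 0 := by
  have h := congrFun (congrFun hB j) j
  simp only [Matrix.mul_apply] at h
  simp only [laxM, Matrix.of_apply, Finset.sum_sub_distrib, Finset.sum_ite_eq',
    Finset.mem_univ, if_true]
  rw [← Finset.sum_sub_distrib]
  rw [← sub_eq_zero, ← Finset.sum_sub_distrib, ← neg_eq_zero, ← Finset.sum_neg_distrib] at h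
  rw [← h]
  refine Finset.sum_congr rfl fun i _ => ?_
  by_cases hij : i = j
  · subst hij; simp; ring
  · simp only [laxMatrix, Matrix.of_apply, if_neg hij, if_neg (Ne.symm hij)]
    rw [← neg_sub (x i) (x j), one_div_neg_eq_neg_one_div]; ring

theorem lax_X {n : ℕ} {x : Fin n → ℝ} (hx : Function.Injective x)
    (B : Matrix (Fin n) (Fin n) ℝ) :
    Matrix.diagonal (fun i => - B i i) =
      -B + (Matrix.diagonal x * laxM x B - laxM x B * Matrix.diagonal x) := by
  ext i j
  simp only [Matrix.add_apply, Matrix.neg_apply, Matrix.sub_apply, Matrix.diagonal_mul,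
    Matrix.mul_diagonal, laxM, Matrix.of_apply]
  by_cases h : i = j
  · subst h; simp; ring
  · have hne : x i - x j ≠ 0 := sub_ne_zero.2 fun e => h (hx e)
    simp [h]; field_simp; ring

theorem lax_XL {n : ℕ} {x : Fin n → ℝ} (hx : Function.Injective x) (p : Fin n → ℝ) :
    Matrix.diagonal x * laxMatrix x p - laxMatrix x p * Matrix.diagonal x =
      (Matrix.of fun _ _ => (1 : ℝ)) - 1 := by
  ext i j
  simp only [Matrix.sub_apply, Matrix.diagonal_mul,
    Matrix.mul_diagonal, laxMatrix, Matrix.of_apply]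
  by_cases h : i = j
  · subst h; simp; ring
  · have hne : x i - x j ≠ 0 := sub_ne_zero.2 fun e => h (hx e)
    simp [h]; field_simp

theorem laxM_J {n : ℕ} (x p : Fin n → ℝ) (B : Matrix (Fin n) (Fin n) ℝ)
    (hB : laxMatrix x p * B = B * laxMatrix x p) :
    laxM x B * (Matrix.of fun _ _ => (1 : ℝ)) = 0 ∧
    (Matrix.of fun _ _ => (1 : ℝ)) * laxM x B = 0 := by
  constructor
  · ext i j; simp [Matrix.mul_apply, laxM_row]
  · ext i j; simp [Matrix.mul_apply, laxM_col x p B hB]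

theorem lax_eq {n : ℕ} {x : Fin n → ℝ} (hx : Function.Injective x) (p : Fin n → ℝ)
    (B : Matrix (Fin n) (Fin n) ℝ) (hB : laxMatrix x p * B = B * laxMatrix x p) :
    laxD x (fun i => - B i i) (fun i => ∑ j, (B i j - B j i) * (1 / (x i - x j)) ^ 2) =
      laxMatrix x p * laxM x B - laxM x B * laxMatrix x p := by
  set D := laxD x (fun i => - B i i) (fun i => ∑ j, (B i j - B j i) * (1 / (x i - x j)) ^ 2)
    with hD
  set L := laxMatrix x p with hL
  set M := laxM x B with hM
  set X := Matrix.diagonal x with hXd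
  set X' := Matrix.diagonal (fun i => - B i i) with hX'd
  have e1 : X' * L - L * X' + (X * D - D * X) = 0 := by
    ext i j
    simp only [Matrix.sub_apply, Matrix.add_apply, hX'd, hXd, Matrix.diagonal_mul,
      Matrix.mul_diagonal, hL, hD, laxD, laxMatrix, Matrix.of_apply]
    by_cases h : i = j
    · subst h; simp; ring
    · have hne : x i - x j ≠ 0 := sub_ne_zero.2 fun e => h (hx e)
      simp [h]; field_simp; ring
  have e2 : X' = -B + (X * M - M * X) := lax_X hx B
  have e3 := lax_XL hx p
  obtain ⟨j1, j2⟩ := laxM_J x p B hB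
  have e4 : (X * L - L * X) * M - M * (X * L - L * X) = 0 := by
    rw [e3, sub_mul, mul_sub, j1, j2]; simp
  have e5 : X * (D - (L * M - M * L)) = (D - (L * M - M * L)) * X := by
    have e1' : X * D - D * X = -(X' * L - L * X') := by
      rw [eq_neg_iff_add_eq_zero, add_comm]; exact e1
    have e6 : X' * L - L * X' = (X * M - M * X) * L - L * (X * M - M * X) := by
      have : X' * L - L * X' = (L * B - B * L) + ((X * M - M * X) * L - L * (X * M - M * X)) := by
        rw [e2]; noncomm_ring
      rw [this, hB, sub_self, zero_add]
    rw [e6] at e1'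
    rw [← sub_eq_zero]
    have : X * (D - (L * M - M * L)) - (D - (L * M - M * L)) * X =
      (X * D - D * X) + ((X * M - M * X) * L - L * (X * M - M * X)) -
        ((X * L - L * X) * M - M * (X * L - L * X)) := by noncomm_ring
    rw [this, e4, e1']; simp
  ext i j
  by_cases h : i = j
  · subst h
    simp only [hD, laxD, Matrix.of_apply, if_true, Matrix.sub_apply, Matrix.mul_apply]
    rw [← Finset.sum_sub_distrib]
    refine Finset.sum_congr rfl fun j _ => ?_
    by_cases hij : i = j
    · subst hij; simp; ring
    · simp only [hL, hM, laxM, laxMatrix, Matrix.of_apply, if_neg hij, if_neg (Ne.symm hij)]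
      rw [← neg_sub (x i) (x j), one_div_neg_eq_neg_one_div]; ring
  · have hne : x i - x j ≠ 0 := sub_ne_zero.2 fun e => h (hx e)
    have := congrFun (congrFun e5 i) j
    rw [hXd, Matrix.diagonal_mul, Matrix.mul_diagonal, mul_comm, ← sub_eq_zero, ← mul_sub] at this
    have := (mul_eq_zero.1 this).resolve_right hne
    rwa [Matrix.sub_apply, sub_eq_zero] at this

theorem ham_line {n : ℕ} {z : (Fin n → ℝ) × (Fin n → ℝ)} (hx : Function.Injective z.1)
    (v : (Fin n → ℝ) × (Fin n → ℝ)) (k : ℕ) (hk : 1 ≤ k) :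
    HasDerivAt (fun s : ℝ => (1 / (k : ℝ)) *
        ((laxMatrix (z + s • v).1 (z + s • v).2) ^ k).trace)
      ((laxMatrix z.1 z.2) ^ (k - 1) * laxD z.1 v.1 v.2).trace 0 := by
  obtain ⟨D, hD, h⟩ := (lax_line hx v).pow_trace k
  have h1 := hD.trace.const_mul (1 / (k : ℝ))
  refine h1.congr_deriv ?_
  have h2 := h 1 (Commute.one_right _)
  have : (k : ℝ) ≠ 0 := by positivity
  simp only [mul_one, zero_smul, add_zero] at h2
  rw [h2]; field_simp

theorem tr_p {n : ℕ} (x : Fin n → ℝ) (B : Matrix (Fin n) (Fin n) ℝ) (i : Fin n) :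
    (B * laxD x 0 (Pi.single i 1)).trace = B i i := by
  have : laxD x 0 (Pi.single i 1) = Matrix.single i i 1 := by
    ext a b
    simp only [laxD, Matrix.of_apply, Matrix.single_apply, Pi.single_apply, Pi.zero_apply]
    grind
  rw [this, Matrix.trace_mul_single]; simp

theorem tr_x {n : ℕ} (x : Fin n → ℝ) (B : Matrix (Fin n) (Fin n) ℝ) (i : Fin n) :
    (B * laxD x (Pi.single i 1) 0).trace = ∑ j, (B i j - B j i) * (1 / (x i - x j)) ^ 2 := by
  have : ∀ a b, laxD x (Pi.single i 1) 0 a b =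
      (if b = i then (1 / (x a - x i)) ^ 2 else 0) - if a = i then (1 / (x i - x b)) ^ 2 else 0 := by
    intro a b
    simp only [laxD, Matrix.of_apply, Pi.single_apply, Pi.zero_apply]
    split_ifs <;> simp_all
  simp only [Matrix.trace, Matrix.diag, Matrix.mul_apply, this, mul_sub, mul_ite, mul_zero,
    Finset.sum_sub_distrib, Finset.sum_ite_eq', Finset.mem_univ, if_true, sub_mul]
  congr 1
  · rw [Finset.sum_comm]
    simp only [Finset.sum_ite_eq', Finset.mem_univ, if_true]
    refine Finset.sum_congr rfl fun a _ => ?_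
    rw [← neg_sub (x i) (x a), one_div_neg_eq_neg_one_div, neg_sq]

theorem bracket_zero {n : ℕ} {F G : (Fin n → ℝ) × (Fin n → ℝ) → ℝ}
    {z : (Fin n → ℝ) × (Fin n → ℝ)} {a b : Fin n → ℝ}
    (ha : ∀ i, HasDerivAt (fun s : ℝ => F (z + s • ((Pi.single i 1 : Fin n → ℝ), (0 : Fin n → ℝ)))) (a i) 0)
    (hb : ∀ i, HasDerivAt (fun s : ℝ => F (z + s • ((0 : Fin n → ℝ), (Pi.single i 1 : Fin n → ℝ)))) (b i) 0)
    (hG : HasDerivAt (fun s : ℝ => G (z + s • ((fun i => - b i), a))) 0 0) :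
    poissonBracket F G z = 0 := by
  by_cases hFd : DifferentiableAt ℝ F z
  swap
  · simp [poissonBracket, fderiv_zero_of_not_differentiableAt hFd]
  by_cases hGd : DifferentiableAt ℝ G z
  swap
  · simp [poissonBracket, fderiv_zero_of_not_differentiableAt hGd]
  have e1 : ∀ i, fderiv ℝ F z (Pi.single i 1, 0) = a i := fun i => by
    rw [← hFd.lineDeriv_eq_fderiv]; exact HasLineDerivAt.lineDeriv (ha i)
  have e2 : ∀ i, fderiv ℝ F z (0, Pi.single i 1) = b i := fun i => by
    rw [← hFd.lineDeriv_eq_fderiv]; exact HasLineDerivAt.lineDeriv (hb i)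
  have e3 : fderiv ℝ G z ((fun i => - b i), a) = 0 := by
    rw [← hGd.lineDeriv_eq_fderiv]; exact HasLineDerivAt.lineDeriv hG
  have e4 : ((fun i => - b i), a) = ∑ i, (a i • ((0 : Fin n → ℝ), (Pi.single i 1 : Fin n → ℝ))
      - b i • ((Pi.single i 1 : Fin n → ℝ), (0 : Fin n → ℝ))) := by
    ext j <;> simp [Prod.fst_sum, Prod.snd_sum, Finset.sum_apply, Pi.single_apply]
  rw [e4, map_sum] at e3
  simp only [map_sub, map_smul, smul_eq_mul] at e3
  simpa only [poissonBracket, e1, e2] using e3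

theorem quot_deriv {f g : ℝ → ℝ} {c : ℝ} (hf : HasDerivAt f (-(c * g 0)) 0)
    (hg : HasDerivAt g 0 0) (h0 : g 0 ≠ 0) : HasDerivAt (fun s => f s / g s) (-c) 0 := by
  refine (hf.fun_div hg h0).congr_deriv ?_
  field_simp; ring

/-- The differences `μ̃ᵢ − μᵢ` between the Sklyanin and the Darboux–Nijenhuis momenta
Poisson-commute with all the spectral invariants `(1/k)·trace(Lᵏ)` on `U`; hence the
Sklyanin momenta are magnetic Darboux–Nijenhuis coordinates. -/
theorem sklyanin_minus_dn_commutes_with_invariants {n : ℕ} (hn : 1 ≤ n)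
    (U : Set ((Fin n → ℝ) × (Fin n → ℝ))) (hU : IsOpen U)
    (hUx : ∀ z ∈ U, Function.Injective z.1)
    (lam : Fin n → ((Fin n → ℝ) × (Fin n → ℝ)) → ℝ)
    (hlam_smooth : ∀ i, ContDiffOn ℝ (⊤ : ℕ∞) (lam i) U)
    (hlam_distinct : ∀ z ∈ U, ∀ i j, i ≠ j → lam i z ≠ lam j z)
    (hlam_eigen : ∀ z ∈ U, ∀ t : ℝ,
      (t • (1 : Matrix (Fin n) (Fin n) ℝ) - laxMatrix z.1 z.2).det = ∏ i, (t - lam i z)) :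
    ∀ (k : ℕ), 1 ≤ k → ∀ z ∈ U, ∀ i : Fin n,
      poissonBracket (fun w => (1 / (k : ℝ)) * ((laxMatrix w.1 w.2) ^ k).trace)
        (fun w => sklyaninMu lam i w - dnMu lam i w) z = 0 := by
  intro k hk z hz i
  have hx := hUx z hz
  set L := laxMatrix z.1 z.2 with hL
  set B := L ^ (k - 1) with hBdef
  have hB : L * B = B * L := by rw [hBdef, ← pow_succ, ← pow_succ']
  refine bracket_zero (a := fun i => ∑ j, (B i j - B j i) * (1 / (z.1 i - z.1 j)) ^ 2)
    (b := fun i => B i i) (fun j => ?_) (fun j => ?_) ?_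
  · have := ham_line hx ((Pi.single j 1 : Fin n → ℝ), (0 : Fin n → ℝ)) k hk
    rwa [tr_x] at this
  · have := ham_line hx ((0 : Fin n → ℝ), (Pi.single j 1 : Fin n → ℝ)) k hk
    rwa [tr_p] at this
  set v : (Fin n → ℝ) × (Fin n → ℝ) := ((fun i => - B i i),
    fun i => ∑ j, (B i j - B j i) * (1 / (z.1 i - z.1 j)) ^ 2) with hv
  set M := laxM z.1 B with hM
  have hLd : MD (fun s : ℝ => laxMatrix (z + s • v).1 (z + s • v).2) (L * M - M * L) 0 :=
    (lax_line hx v).congr_deriv (lax_eq hx z.2 B hB)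
  have hXd : MD (fun s : ℝ => Matrix.diagonal (z + s • v).1)
      (Matrix.diagonal (fun i => - B i i)) 0 := by
    intro a b
    by_cases h : a = b
    · subst h
      simpa [hv] using ((hasDerivAt_id (0 : ℝ)).mul_const (- B a a)).const_add (z.1 a)
    · simpa [Matrix.diagonal_apply_ne _ h] using hasDerivAt_const _ _
  have hγ : HasDerivAt (fun s : ℝ => z + s • v) v 0 := by
    simpa using ((hasDerivAt_id (0 : ℝ)).smul_const v).const_add z
  have hld : DifferentiableAt ℝ (lam i) z :=
    ((hlam_smooth i).contDiffAt (hU.mem_nhds hz)).differentiableAt (by simp)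
  obtain ⟨l', hl'⟩ : ∃ l', HasDerivAt (fun s : ℝ => lam i (z + s • v)) l' 0 :=
    ⟨_, HasFDerivAt.comp_hasDerivAt (x := (0 : ℝ)) (f := fun s : ℝ => z + s • v)
      (l := lam i) (by simpa using hld.hasFDerivAt) hγ⟩
  set l := lam i z with hl
  set N := l • (1 : Matrix (Fin n) (Fin n) ℝ) - L with hN
  set A := N.adjugate with hA
  have hNd : MD (fun s : ℝ => lam i (z + s • v) • (1 : Matrix (Fin n) (Fin n) ℝ) -
      laxMatrix (z + s • v).1 (z + s • v).2) (l' • 1 - (L * M - M * L)) 0 := by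
    intro a b
    have := (hl'.mul_const ((1 : Matrix (Fin n) (Fin n) ℝ) a b)).fun_sub (hLd a b)
    simpa using this
  have hdet : N.det = 0 := by
    rw [hN, hL, hlam_eigen z hz]
    exact Finset.prod_eq_zero (Finset.mem_univ i) (by simp [hl])
  have hNA : N * A = 0 := by rw [hA, Matrix.mul_adjugate, hdet, zero_smul]
  have hAN : A * N = 0 := by rw [hA, Matrix.adjugate_mul, hdet, zero_smul]
  have hLA : L * A = l • A := by
    have : l • A - L * A = 0 := by rw [← hNA, hN, sub_mul, smul_mul_assoc, one_mul]
    exact (sub_eq_zero.1 this).symm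
  have hAL : A * L = l • A := by
    have : l • A - A * L = 0 := by rw [← hAN, hN, mul_sub, mul_smul_comm, mul_one]
    exact (sub_eq_zero.1 this).symm
  -- nonvanishing of the trace
  have htr : A.trace ≠ 0 := by
    have h1 : MD (fun t : ℝ => t • (1 : Matrix (Fin n) (Fin n) ℝ) - L) 1 l := by
      intro a b
      simpa using ((hasDerivAt_id l).mul_const
        ((1 : Matrix (Fin n) (Fin n) ℝ) a b)).sub_const (L a b)
    have h2 := h1.det
    simp only [hL, hlam_eigen z hz] at h2
    have h3 := HasDerivAt.fun_finsetProd (u := Finset.univ) (x := l)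
      (f := fun j t => t - lam j z) (f' := fun _ => 1)
      (fun j _ => (hasDerivAt_id l).sub_const _)
    have h4 := h2.unique h3
    rw [mul_one] at h4
    change A.trace = _ at h4
    rw [h4, Finset.sum_eq_single i]
    · simp only [smul_eq_mul, mul_one]
      refine Finset.prod_ne_zero_iff.2 fun j hj => sub_ne_zero.2 ?_
      exact hlam_distinct z hz i j (Finset.ne_of_mem_erase hj).symm
    · intro j _ hj
      rw [Finset.prod_eq_zero (i := i) (by simp [hj.symm]) (by simp [hl]), zero_smul]
    · simp
  -- the eigenvalue is conserved
  have hl0 : l' = 0 := by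
    have h1 := hNd.det
    have h2 : HasDerivAt (fun s : ℝ => (lam i (z + s • v) • (1 : Matrix (Fin n) (Fin n) ℝ) -
      laxMatrix (z + s • v).1 (z + s • v).2).det) 0 0 := by
      refine (hasDerivAt_const (0 : ℝ) (0 : ℝ)).congr_of_eventuallyEq ?_
      have : ∀ᶠ s : ℝ in nhds 0, z + s • v ∈ U :=
        hγ.continuousAt.eventually_mem (hU.mem_nhds (by simpa using hz))
      filter_upwards [this] with s hs
      rw [hlam_eigen _ hs]
      exact Finset.prod_eq_zero (Finset.mem_univ i) (by simp)
    have h3 := h1.unique h2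
    simp only [zero_smul, add_zero] at h3
    change (A * (l' • 1 - (L * M - M * L))).trace = 0 at h3
    rw [mul_sub, mul_sub, ← mul_assoc, hAL, Matrix.trace_sub, Matrix.trace_sub,
      ← mul_assoc A M L, Matrix.trace_mul_comm (A * M) L, ← mul_assoc, hLA, sub_self, sub_zero,
      mul_smul_comm, mul_one, Matrix.trace_smul, smul_eq_mul] at h3
    exact (mul_eq_zero.1 h3).resolve_right htr
  have hAd : MD (fun s : ℝ => (lam i (z + s • v) • (1 : Matrix (Fin n) (Fin n) ℝ) -
      laxMatrix (z + s • v).1 (z + s • v).2).adjugate) (A * M - M * A) 0 := by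
    have h1 := hNd.adj
    refine h1.congr_deriv ?_
    rw [hA, ← dadj_comm]
    simp only [zero_smul, add_zero]
    change dadj N _ = _
    congr 1
    rw [hl0, hN]
    simp only [sub_mul, mul_sub, smul_mul_assoc, mul_smul_comm, one_mul, mul_one, zero_smul]
    abel
  have hX := lax_X hx B
  -- quotient for a general C
  have hquot : ∀ C : Matrix (Fin n) (Fin n) ℝ, M * C = C * M → (A * C).trace ≠ 0 →
      HasDerivAt (fun s : ℝ => (Matrix.diagonal (z + s • v).1 *
        (lam i (z + s • v) • (1 : Matrix (Fin n) (Fin n) ℝ) -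
          laxMatrix (z + s • v).1 (z + s • v).2).adjugate * C).trace /
        ((lam i (z + s • v) • (1 : Matrix (Fin n) (Fin n) ℝ) -
          laxMatrix (z + s • v).1 (z + s • v).2).adjugate * C).trace) (-(l ^ (k-1))) 0 := by
    intro C hC h0
    obtain ⟨c1, c2⟩ := core hX hBdef hLA hC
    have d1 := ((hXd.mul hAd).mul (MD.const C 0)).trace
    have d2 := (hAd.mul (MD.const C 0)).trace
    simp only [mul_zero, add_zero, zero_smul] at d1 d2
    refine quot_deriv ?_ ?_ ?_
    · refine d1.congr_deriv ?_
      simp only [zero_smul, add_zero]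
      rw [← c1, add_mul]
    · rw [c2] at d2; exact d2
    · simpa only [zero_smul, add_zero] using h0
  obtain ⟨j1, j2⟩ := laxM_J z.1 z.2 B hB
  have q1 := hquot 1 (by simp) (by simpa using htr)
  have hAJ : (A * (Matrix.of fun _ _ => (1 : ℝ))).trace = A.trace := by
    have : (A * (Matrix.of fun _ _ => (1 : ℝ)) - A).trace = 0 := by
      have e : A * (Matrix.of fun _ _ => (1 : ℝ)) - A =
          A * ((Matrix.of fun _ _ => (1 : ℝ)) - 1) := by rw [mul_sub, mul_one]
      rw [e, ← lax_XL hx z.2, mul_sub, ← mul_assoc, ← mul_assoc, Matrix.trace_sub,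
        Matrix.trace_mul_comm, ← mul_assoc]
      change (L * A * _).trace - (A * L * _).trace = 0
      rw [hLA, hAL, sub_self]
    rw [Matrix.trace_sub, sub_eq_zero] at this
    exact this
  have q2 := hquot (Matrix.of fun _ _ => (1 : ℝ)) (by rw [j1, j2]) (by rw [hAJ]; exact htr)
  have q3 := q2.fun_sub q1
  rw [sub_self] at q3
  refine q3.congr_of_eventuallyEq (Filter.Eventually.of_forall fun s => ?_)
  simp only [mul_one, sklyaninMu, dnMu]
  congr 2
  · rw [mul_assoc]
    simp only [Matrix.trace, Matrix.diag, Matrix.diagonal_mul]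
    simp only [Matrix.mul_apply, dotProduct, Matrix.mulVec, Matrix.of_apply, mul_one]
  · simp only [Matrix.trace, Matrix.diag, Matrix.mul_apply, dotProduct, Matrix.mulVec,
      Matrix.of_apply, mul_one, one_mul]
end
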